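/- arXiv:2105.00069 — 2 statements merged into one kernel-verified Lean document; each statement's English description precedes it below -/
import Mathlib

section
/- Let E be a type of events, let r be a binary relation on E representing direct causation, let t : E → ℝ assign virtual timestamps, and let q : E → List ℝ assign tie-breaking sequences. Suppose every direct causation either strictly increases the timestamp (a regular-offset event: t a < t b) or keeps the timestamp equal while appending a new value to the tie-breaking sequence (a zero-offset event: t a = t b and there exists u : ℝ with q b = q a ++ [u]). Then causality respects the signature order: for all a b, if b is reachable from a via the transitive closure of r, then either t a < t b, or t a = t b and q a is strictly less than q b in the lexicographic order on lists of reals (with the convention that a proper prefix is less than any extension). In particular no event's signature can be ordered at or before that of any of its causal ancestors. -/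
theorem List.lt_append_singleton {α : Type*} [LT α] (l : List α) (u : α) : l < l ++ [u] := by
  induction l with
  | nil => exact List.Lex.nil
  | cons x l ih => exact List.Lex.cons ih

/-- Virtual time signatures strictly increase along chains of direct causation. -/
theorem signature_lt_of_transGen {E : Type*} {r : E → E → Prop} {t : E → ℝ} {q : E → List ℝ}
    (hr : ∀ a b : E, r a b → t a < t b ∨ (t a = t b ∧ ∃ u : ℝ, q b = q a ++ [u]))
    {a b : E} (hab : Relation.TransGen r a b) : t a < t b ∨ (t a = t b ∧ q a < q b) := by
  have step : ∀ a b, r a b → toLex (t a, q a) < toLex (t b, q b) := by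
    intro a b h
    rw [Prod.Lex.toLex_lt_toLex]
    refine (hr a b h).imp_right fun ⟨ht, u, hu⟩ => ⟨ht, ?_⟩
    simpa only [hu] using List.lt_append_singleton (q a) u
  rw [← Prod.Lex.toLex_lt_toLex (x := (t a, q a)) (y := (t b, q b))]
  induction hab with
  | single h => exact step _ _ h
  | tail _ h ih => exact ih.trans (step _ _ h)

/-- Sequence-based tie-breaking: if every direct causation either strictly increases the
timestamp (regular-offset) or keeps it equal while appending a new value to the
tie-breaking sequence (zero-offset), then causality respects the signature order:
any causal descendant has strictly greater signature, and in particular its signature is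
never at or before that of a causal ancestor. -/
theorem sequence_tiebreaker_causal {E : Type*} (r : E → E → Prop)
    (t : E → ℝ) (q : E → List ℝ)
    (hr : ∀ a b : E, r a b →
      t a < t b ∨ (t a = t b ∧ ∃ u : ℝ, q b = q a ++ [u])) :
    ∀ a b : E, Relation.TransGen r a b →
      (t a < t b ∨ (t a = t b ∧ List.Lex (· < ·) (q a) (q b))) ∧
      ¬ (t b < t a ∨ (t b = t a ∧ (List.Lex (· < ·) (q b) (q a) ∨ q b = q a))) := by
  intro a b hab
  have h := signature_lt_of_transGen hr hab
  refine ⟨h, ?_⟩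
  change ¬ (t b < t a ∨ (t b = t a ∧ (q b < q a ∨ q b = q a)))
  rintro (ht | ⟨ht, hq⟩) <;> rcases h with h | ⟨h, hlt⟩
  · exact lt_asymm h ht
  · exact ht.ne' h
  · exact h.ne' ht
  · rcases hq with hq | hq
    · exact lt_asymm hlt hq
    · exact hlt.ne' hq
end

section
/- Let E be a type of events, let r be a binary relation on E representing direct causation, let t : E → ℝ assign virtual timestamps, and let q : E → List ℝ assign tie-breaking sequences, such that every direct causation either strictly increases the timestamp, or keeps the timestamp equal while appending a new value to the tie-breaking sequence (for all a b, r a b implies t a < t b, or t a = t b and q b = q a ++ [u] for some u : ℝ). Suppose moreover that the signature map e ↦ (t e, q e) is injective. Define the relation s on E by: s a b iff t a < t b, or (t a = t b and q a is strictly less than q b in the lexicographic order on lists of reals, with a proper prefix less than any extension). Then s is a strict total order on E (irreflexive, transitive, any two distinct events comparable) extending the causality relation: for all a b, if b is reachable from a via the transitive closure of r, then s a b. -/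
/-- A list is lexicographically smaller than any list obtained by appending an element. -/
theorem List.lex_append_singleton {α : Type*} (R : α → α → Prop) (l : List α) (u : α) :
    List.Lex R l (l ++ [u]) := by
  induction l with
  | nil => exact List.Lex.nil
  | cons x l ih => exact List.Lex.cons ih

/-- Sequence-based tie-breaking with injective signatures yields a strict total order
on all events (including zero-offset events) extending the causality relation. -/
theorem sequence_tiebreaker_total_order {E : Type*} (r : E → E → Prop)
    (t : E → ℝ) (q : E → List ℝ)
    (hr : ∀ a b : E, r a b →
      t a < t b ∨ (t a = t b ∧ ∃ u : ℝ, q b = q a ++ [u]))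
    (hinj : Function.Injective (fun e : E => (t e, q e)))
    (s : E → E → Prop)
    (hs : ∀ a b : E, s a b ↔
      t a < t b ∨ (t a = t b ∧ List.Lex (· < ·) (q a) (q b))) :
    (∀ a : E, ¬ s a a) ∧
    (∀ a b c : E, s a b → s b c → s a c) ∧
    (∀ a b : E, a ≠ b → s a b ∨ s b a) ∧
    (∀ a b : E, Relation.TransGen r a b → s a b) := by
  have lex_iff : ∀ l m : List ℝ, List.Lex (· < ·) l m ↔ l < m := fun _ _ => Iff.rfl
  have trans : ∀ a b c : E, s a b → s b c → s a c := by
    intro a b c hab hbc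
    rw [hs, lex_iff] at *
    rcases hab with hab | ⟨hab, lab⟩ <;> rcases hbc with hbc | ⟨hbc, lbc⟩
    · exact Or.inl (hab.trans hbc)
    · exact Or.inl (hbc ▸ hab)
    · exact Or.inl (hab ▸ hbc)
    · exact Or.inr ⟨hab.trans hbc, lab.trans lbc⟩
  have step : ∀ a b : E, r a b → s a b := by
    intro a b hab
    rw [hs]
    refine (hr a b hab).imp_right ?_
    rintro ⟨ht, u, hu⟩
    exact ⟨ht, hu ▸ List.lex_append_singleton _ _ u⟩
  refine ⟨fun a => ?_, trans, fun a b hab => ?_, fun a b hab => ?_⟩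
  · rw [hs, lex_iff]
    simp
  · rw [hs, hs, lex_iff, lex_iff]
    rcases lt_trichotomy (t a) (t b) with h | h | h
    · exact Or.inl (Or.inl h)
    · rcases lt_trichotomy (q a) (q b) with h' | h' | h'
      · exact Or.inl (Or.inr ⟨h, h'⟩)
      · exact absurd (hinj (Prod.ext h h')) hab
      · exact Or.inr (Or.inr ⟨h.symm, h'⟩)
    · exact Or.inr (Or.inl h)
  · induction hab with
    | single h => exact step _ _ h
    | tail _ h ih => exact trans _ _ _ ih (step _ _ h)
end
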